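/- Let (Ω, 𝓕, ℙ) be a probability space with a filtration (𝓕_n)_{n≥0}, and let e_n, α_n, β_n, η_n (n ≥ 0) be finite, nonnegative, integrable, 𝓕_n-measurable real random variables such that almost surely ∑_{n=0}^∞ α_n < ∞, ∑_{n=0}^∞ β_n < ∞, and E[e_{n+1} | 𝓕_n] ≤ (1 + α_n)·e_n + β_n − η_n for every n. Then almost surely the sequence (e_n) converges to a finite limit and ∑_{n=0}^∞ η_n < ∞. -/

import Mathlib

open MeasureTheory Filter

theorem MeasureTheory.Supermartingale.ae_exists_tendsto_of_nonneg
    {Ω : Type*} [m0 : MeasurableSpace Ω] {μ : Measure Ω} [IsFiniteMeasure μ]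
    {ℱ : Filtration ℕ m0} {X : ℕ → Ω → ℝ} (hX : Supermartingale X ℱ μ)
    (h_nonneg : ∀ n ω, 0 ≤ X n ω) :
    ∀ᵐ ω ∂μ, ∃ l : ℝ, Tendsto (fun n => X n ω) atTop (nhds l) := by
  have h_bdd : ∀ n, eLpNorm ((-X) n) 1 μ ≤ (∫ ω, X 0 ω ∂μ).toNNReal := by
    intro n
    have h_le : ∫ ω, X n ω ∂μ ≤ ∫ ω, X 0 ω ∂μ := by
      simpa using hX.setIntegral_le (Nat.zero_le n) MeasurableSet.univ
    rw [Pi.neg_apply, eLpNorm_neg, eLpNorm_one_eq_lintegral_enorm,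
      ← ofReal_integral_norm_eq_lintegral_enorm (hX.integrable n)]
    simp only [Real.norm_of_nonneg (h_nonneg n _)]
    exact ENNReal.ofReal_le_ofReal h_le
  filter_upwards [hX.neg.exists_ae_tendsto_of_bdd h_bdd] with ω ⟨l, hl⟩
  exact ⟨-l, by simpa using hl.neg⟩

/-- The discounted process `(e n + 1) / ∏_{k < n} (1 + γ k)`, compensated by the discounted
sum of the `η k`, `k < n`. -/
noncomputable def discountedProcess {Ω : Type*} (e γ η : ℕ → Ω → ℝ) (n : ℕ) (ω : Ω) : ℝ :=
  (∏ k ∈ Finset.range n, (1 + γ k ω))⁻¹ * (e n ω + 1) +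
    ∑ j ∈ Finset.range n, (∏ k ∈ Finset.range (j + 1), (1 + γ k ω))⁻¹ * η j ω

theorem one_le_prod_one_add {u : ℕ → ℝ} (hu : ∀ n, 0 ≤ u n) (n : ℕ) :
    1 ≤ ∏ k ∈ Finset.range n, (1 + u k) :=
  Finset.one_le_prod fun k _ => le_add_of_nonneg_right (hu k)

theorem measurable_inv_prod_one_add {Ω : Type*} [m0 : MeasurableSpace Ω] {ℱ : Filtration ℕ m0}
    {γ : ℕ → Ω → ℝ} (hγ : ∀ n, Measurable[ℱ n] (γ n)) {n i : ℕ} (hn : n ≤ i + 1) :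
    Measurable[ℱ i] fun ω => (∏ k ∈ Finset.range n, (1 + γ k ω))⁻¹ := by
  refine Measurable.inv (Finset.measurable_fun_prod _ fun k hk => ?_)
  have hk' : k ≤ i := by have := Finset.mem_range.1 hk; omega
  exact measurable_const.add ((hγ k).mono (ℱ.mono hk') le_rfl)

theorem supermartingale_discountedProcess
    {Ω : Type*} [m0 : MeasurableSpace Ω] {μ : Measure Ω} [IsFiniteMeasure μ]
    {ℱ : Filtration ℕ m0} {e γ η : ℕ → Ω → ℝ}
    (he_meas : ∀ n, Measurable[ℱ n] (e n))
    (hγ_meas : ∀ n, Measurable[ℱ n] (γ n))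
    (hη_meas : ∀ n, Measurable[ℱ n] (η n))
    (hγ_nonneg : ∀ n ω, 0 ≤ γ n ω)
    (he_int : ∀ n, Integrable (e n) μ)
    (hη_int : ∀ n, Integrable (η n) μ)
    (hrec : ∀ n, μ[e (n + 1) | ℱ n] ≤ᵐ[μ]
      fun ω => (1 + γ n ω) * (e n ω + 1) - η n ω - 1) :
    Supermartingale (discountedProcess e γ η) ℱ μ := by
  set W : ℕ → Ω → ℝ := fun n ω => (∏ k ∈ Finset.range n, (1 + γ k ω))⁻¹ with hW
  have hD : ∀ n ω, 1 ≤ ∏ k ∈ Finset.range n, (1 + γ k ω) :=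
    fun n ω => one_le_prod_one_add (fun k => hγ_nonneg k ω) n
  have hW_pos : ∀ n ω, 0 < W n ω := fun n ω => inv_pos.2 (by linarith [hD n ω])
  have hW_le : ∀ n ω, ‖W n ω‖ ≤ 1 := fun n ω => by
    rw [Real.norm_of_nonneg (hW_pos n ω).le]
    exact inv_le_one_of_one_le₀ (hD n ω)
  have hW_meas : ∀ {n i}, n ≤ i + 1 → Measurable[ℱ i] (W n) :=
    fun h => measurable_inv_prod_one_add hγ_meas h
  have hW_mul : ∀ n ω, W (n + 1) ω * (1 + γ n ω) = W n ω := fun n ω => by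
    have h1 : (1 + γ n ω) ≠ 0 := by linarith [hγ_nonneg n ω]
    simp only [hW, Finset.prod_range_succ, mul_inv]
    rw [inv_mul_cancel_right₀ h1]
  have hW_int_mul : ∀ n {f : Ω → ℝ}, Integrable f μ → Integrable (W n * f) μ :=
    fun n f hf => hf.bdd_mul
      ((hW_meas (Nat.le_succ n)).mono (ℱ.le n) le_rfl).aestronglyMeasurable
      (ae_of_all _ (hW_le n))
  set T : ℕ → Ω → ℝ := fun n => ∑ j ∈ Finset.range n, W (j + 1) * η j with hT
  have hT_meas : ∀ {n i}, n ≤ i + 1 → Measurable[ℱ i] (T n) := fun {n i} h => by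
    rw [show T n = fun ω => ∑ j ∈ Finset.range n, (W (j + 1) * η j) ω from Finset.sum_fn _ _]
    refine Finset.measurable_sum _ fun j hj => ?_
    have hj' : j ≤ i := by have := Finset.mem_range.1 hj; omega
    exact (hW_meas (by omega)).mul ((hη_meas j).mono (ℱ.mono hj') le_rfl)
  have hT_int : ∀ n, Integrable (T n) μ :=
    fun n => integrable_finsetSum' _ fun j _ => hW_int_mul _ (hη_int j)
  have hX : discountedProcess e γ η = fun n => W n * e n + (W n + T n) := by
    funext n ω
    simp only [discountedProcess, hT, hW, Pi.add_apply, Pi.mul_apply, Finset.sum_apply]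
    ring
  have hW_int : ∀ n, Integrable (W n) μ := fun n => by
    simpa using hW_int_mul n (f := 1) (integrable_const 1)
  rw [hX]
  refine supermartingale_nat (fun n => ?_) (fun n => ?_) fun n => ?_
  · exact (((hW_meas (Nat.le_succ n)).mul (he_meas n)).add
      ((hW_meas (Nat.le_succ n)).add (hT_meas (Nat.le_succ n)))).stronglyMeasurable
  · exact (hW_int_mul n (he_int n)).add ((hW_int n).add (hT_int n))
  · have hWT : μ[W (n + 1) + T (n + 1) | ℱ n] = W (n + 1) + T (n + 1) :=
      condExp_of_stronglyMeasurable (ℱ.le n)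
        ((hW_meas le_rfl).add (hT_meas le_rfl)).stronglyMeasurable
        ((hW_int _).add (hT_int _))
    filter_upwards [hrec n,
      condExp_add (hW_int_mul (n + 1) (he_int (n + 1))) ((hW_int (n + 1)).add (hT_int (n + 1)))
        (ℱ n),
      condExp_mul_of_stronglyMeasurable_left (hW_meas (le_refl (n + 1))).stronglyMeasurable
        (hW_int_mul (n + 1) (he_int (n + 1))) (he_int (n + 1))] with ω h_rec h_add h_mul
    rw [h_add, Pi.add_apply, hWT, h_mul]
    have hTs : T (n + 1) ω = T n ω + W (n + 1) ω * η n ω := by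
      simp [hT, Finset.sum_range_succ]
    simp only [Pi.add_apply, Pi.mul_apply, hTs]
    have := mul_le_mul_of_nonneg_left h_rec (hW_pos (n + 1) ω).le
    linear_combination this + (e n ω + 1) * hW_mul n ω

theorem tendsto_and_summable_of_tendsto_discountedProcess {Ω : Type*} {e γ η : ℕ → Ω → ℝ} {ω : Ω}
    (he : ∀ n, 0 ≤ e n ω) (hγ : ∀ n, 0 ≤ γ n ω) (hη : ∀ n, 0 ≤ η n ω)
    (hγ_sum : Summable fun n => γ n ω)
    (h : ∃ l : ℝ, Tendsto (fun n => discountedProcess e γ η n ω) atTop (nhds l)) :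
    (∃ l : ℝ, Tendsto (fun n => e n ω) atTop (nhds l)) ∧ Summable fun n => η n ω := by
  obtain ⟨l, hl⟩ := h
  set D : ℕ → ℝ := fun n => ∏ k ∈ Finset.range n, (1 + γ k ω) with hD
  have hD_one : ∀ n, 1 ≤ D n := one_le_prod_one_add hγ
  have hD_pos : ∀ n, 0 < D n := fun n => by linarith [hD_one n]
  obtain ⟨d, hd⟩ : ∃ d, Tendsto D atTop (nhds d) :=
    ⟨_, (Real.multipliable_one_add_of_summable hγ_sum).hasProd.tendsto_prod_nat⟩
  have hX : ∀ n, discountedProcess e γ η n ω =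
      (D n)⁻¹ * (e n ω + 1) + ∑ j ∈ Finset.range n, (D (j + 1))⁻¹ * η j ω := fun n => rfl
  have h_term : ∀ j, 0 ≤ (D (j + 1))⁻¹ * η j ω :=
    fun j => mul_nonneg (inv_pos.2 (hD_pos _)).le (hη j)
  have h_sum : Summable fun j => (D (j + 1))⁻¹ * η j ω := by
    obtain ⟨c, hc⟩ := hl.bddAbove_range
    refine summable_of_sum_range_le h_term (c := c) fun n => ?_
    have h1 := hc ⟨n, rfl⟩
    simp only [hX] at h1
    have h2 := mul_nonneg (inv_pos.2 (hD_pos n)).le (add_nonneg (he n) zero_le_one)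
    linarith
  constructor
  · refine ⟨d * (l - ∑' j, (D (j + 1))⁻¹ * η j ω) - 1, ?_⟩
    refine ((hd.mul (hl.sub h_sum.hasSum.tendsto_sum_nat)).sub_const 1).congr fun n => ?_
    rw [hX, add_sub_cancel_right, mul_inv_cancel_left₀ (hD_pos n).ne', add_sub_cancel_right]
  · obtain ⟨c, hc⟩ := hd.bddAbove_range
    refine Summable.of_nonneg_of_le hη (fun j => ?_) (h_sum.mul_left c)
    calc η j ω = D (j + 1) * ((D (j + 1))⁻¹ * η j ω) := by
          rw [mul_inv_cancel_left₀ (hD_pos _).ne']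
      _ ≤ c * ((D (j + 1))⁻¹ * η j ω) :=
          mul_le_mul_of_nonneg_right (hc ⟨j + 1, rfl⟩) (h_term j)

/-- **Robbins–Siegmund.** If `e, α, β, η` are nonnegative,
integrable, adapted processes with `E[e_{n+1} | 𝓕_n] ≤ (1+α_n)·e_n + β_n − η_n`
for every `n`, and almost surely `∑ α_n < ∞` and `∑ β_n < ∞`, then almost surely
`e_n` converges to a finite limit and `∑ η_n < ∞`. -/
theorem robbins_siegmund
    {Ω : Type*} [m0 : MeasurableSpace Ω] (μ : Measure Ω) [IsProbabilityMeasure μ]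
    (ℱ : Filtration ℕ m0)
    (e α β η : ℕ → Ω → ℝ)
    (he_meas : ∀ n, Measurable[ℱ n] (e n))
    (hα_meas : ∀ n, Measurable[ℱ n] (α n))
    (hβ_meas : ∀ n, Measurable[ℱ n] (β n))
    (hη_meas : ∀ n, Measurable[ℱ n] (η n))
    (he_nonneg : ∀ n ω, 0 ≤ e n ω)
    (hα_nonneg : ∀ n ω, 0 ≤ α n ω)
    (hβ_nonneg : ∀ n ω, 0 ≤ β n ω)
    (hη_nonneg : ∀ n ω, 0 ≤ η n ω)
    (he_int : ∀ n, Integrable (e n) μ)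
    (hα_int : ∀ n, Integrable (α n) μ)
    (hβ_int : ∀ n, Integrable (β n) μ)
    (hη_int : ∀ n, Integrable (η n) μ)
    (hα_sum : ∀ᵐ ω ∂μ, Summable fun n => α n ω)
    (hβ_sum : ∀ᵐ ω ∂μ, Summable fun n => β n ω)
    (hrec : ∀ n, μ[e (n + 1) | ℱ n] ≤ᵐ[μ]
      fun ω => (1 + α n ω) * e n ω + β n ω - η n ω) :
    ∀ᵐ ω ∂μ, (∃ l : ℝ, Tendsto (fun n => e n ω) atTop (nhds l)) ∧
      Summable fun n => η n ω := by
  have h_super := supermartingale_discountedProcess (γ := fun n ω => α n ω + β n ω)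
    he_meas (fun n => (hα_meas n).add (hβ_meas n)) hη_meas
    (fun n ω => add_nonneg (hα_nonneg n ω) (hβ_nonneg n ω)) he_int hη_int fun n => by
      filter_upwards [hrec n] with ω h
      nlinarith [mul_nonneg (hβ_nonneg n ω) (he_nonneg n ω), hα_nonneg n ω]
  have h_nonneg : ∀ n ω, 0 ≤ discountedProcess e (fun n ω => α n ω + β n ω) η n ω := by
    intro n ω
    have hD : ∀ m, 0 ≤ (∏ k ∈ Finset.range m, (1 + (α k ω + β k ω)))⁻¹ := fun m =>
      inv_nonneg.2 (zero_le_one.trans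
        (one_le_prod_one_add (fun k => add_nonneg (hα_nonneg k ω) (hβ_nonneg k ω)) m))
    exact add_nonneg (mul_nonneg (hD n) (add_nonneg (he_nonneg n ω) zero_le_one))
      (Finset.sum_nonneg fun j _ => mul_nonneg (hD _) (hη_nonneg j ω))
  filter_upwards [h_super.ae_exists_tendsto_of_nonneg h_nonneg, hα_sum, hβ_sum] with ω hω hα hβ
  exact tendsto_and_summable_of_tendsto_discountedProcess (fun n => he_nonneg n ω)
    (fun n => add_nonneg (hα_nonneg n ω) (hβ_nonneg n ω)) (fun n => hη_nonneg n ω)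
    (hα.add hβ) hω
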